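/- arXiv:2410.18992 — 4 statements merged into one kernel-verified Lean document; each statement's English description precedes it below -/
import Mathlib

section
/- Let k be an algebraically closed field with char k ≠ 2, n ≥ 1 a natural number, and a : Matrix (Fin n) (Fin n) k a matrix with det a ≠ 0. For natural numbers d₀, d₁, d₂ the following are equivalent: (1) there exist families A : Fin n → Matrix (Fin d₂) (Fin d₁) k and C : Fin n → Matrix (Fin d₁) (Fin d₀) k such that ∑_{i,j} (a i j) • (A i * C j) = 0, ⨆_i LinearMap.range (Matrix.mulVecLin (C i)) = ⊤ in (Fin d₁ → k), and ⨆_i LinearMap.range (Matrix.mulVecLin (A i)) = ⊤ in (Fin d₂ → k); (2) d₁ ≤ n·d₀ and n·d₂ ≤ (n²−1)·d₁. -/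
open Module

/-- A linear surjection exists whenever the dimension of the target is at most that of the source. -/
theorem exists_surjective_linearMap_of_finrank_le {k M N : Type*} [Field k]
    [AddCommGroup M] [Module k M] [FiniteDimensional k M]
    [AddCommGroup N] [Module k N] [FiniteDimensional k N]
    (h : finrank k N ≤ finrank k M) : ∃ f : M →ₗ[k] N, Function.Surjective f := by
  let e := (finBasis k M).equivFun
  let e' := (finBasis k N).equivFun
  refine ⟨e'.symm.toLinearMap ∘ₗ LinearMap.funLeft k k (Fin.castLE h) ∘ₗ e.toLinearMap, ?_⟩
  exact e'.symm.surjective.comp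
    ((LinearMap.funLeft_surjective_of_injective k k _ (Fin.castLE_injective h)).comp e.surjective)

theorem LinearMap.lsum_surjective_of_iSup_range_eq_top {ι k M N : Type*} [Fintype ι]
    [DecidableEq ι] [Field k] [AddCommGroup M] [Module k M] [AddCommGroup N] [Module k N]
    {f : ι → M →ₗ[k] N} (hf : ⨆ i, LinearMap.range (f i) = ⊤) :
    Function.Surjective (LinearMap.lsum k (fun _ : ι => M) k f) := by
  rw [← LinearMap.range_eq_top, eq_top_iff, ← hf, iSup_le_iff]
  rintro i _ ⟨x, rfl⟩
  exact ⟨Pi.single i x, LinearMap.lsum_piSingle _ _ _ _ _ _⟩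

theorem iSup_range_comp_single_eq_top {ι k M N : Type*} [Fintype ι]
    [DecidableEq ι] [Field k] [AddCommGroup M] [Module k M] [AddCommGroup N] [Module k N]
    {f : (ι → M) →ₗ[k] N} (hf : Function.Surjective f) :
    ⨆ i, LinearMap.range (f ∘ₗ LinearMap.single k (fun _ : ι => M) i) = ⊤ := by
  simp_rw [LinearMap.range_comp]
  rw [← Submodule.map_iSup, LinearMap.iSup_range_single, Submodule.map_top,
    LinearMap.range_eq_top.2 hf]

theorem finrank_le_card_mul_of_iSup_range_eq_top {ι k M N : Type*} [Fintype ι] [Field k]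
    [AddCommGroup M] [Module k M] [FiniteDimensional k M] [AddCommGroup N] [Module k N]
    {f : ι → M →ₗ[k] N} (hf : ⨆ i, LinearMap.range (f i) = ⊤) :
    finrank k N ≤ Fintype.card ι * finrank k M := by
  classical
  simpa [finrank_pi_fintype] using LinearMap.finrank_le_finrank_of_surjective
    (LinearMap.lsum_surjective_of_iSup_range_eq_top hf)

/-- Families of maps `V₀ → V₁ → V₂` with jointly surjective members and `∑ fᵢ gᵢ = 0` exist exactly
under two numerical conditions on the dimensions. -/
theorem exists_jointly_surjective_sum_comp_eq_zero_iff {ι k V₀ V₁ V₂ : Type*} [Fintype ι]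
    [Nonempty ι] [Field k] [AddCommGroup V₀] [Module k V₀] [FiniteDimensional k V₀]
    [AddCommGroup V₁] [Module k V₁] [FiniteDimensional k V₁]
    [AddCommGroup V₂] [Module k V₂] [FiniteDimensional k V₂] :
    (∃ (f : ι → V₁ →ₗ[k] V₂) (g : ι → V₀ →ₗ[k] V₁), ∑ i, f i ∘ₗ g i = 0 ∧
      ⨆ i, LinearMap.range (g i) = ⊤ ∧ ⨆ i, LinearMap.range (f i) = ⊤) ↔
    finrank k V₁ ≤ Fintype.card ι * finrank k V₀ ∧
      Fintype.card ι * finrank k V₂ + finrank k V₁ ≤ Fintype.card ι ^ 2 * finrank k V₁ := by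
  classical
  constructor
  · rintro ⟨f, g, h0, hg, hf⟩
    refine ⟨finrank_le_card_mul_of_iSup_range_eq_top hg, ?_⟩
    let F := LinearMap.lsum k (fun _ : ι => V₁) k f
    let P := LinearMap.pi g
    have hPF : LinearMap.range P ≤ LinearMap.ker F := by
      rintro _ ⟨x, rfl⟩
      simpa [F, P, LinearMap.sum_apply] using LinearMap.congr_fun h0 x
    have hF := F.finrank_range_add_finrank_ker
    rw [LinearMap.range_eq_top.2 (LinearMap.lsum_surjective_of_iSup_range_eq_top hf), finrank_top,
      finrank_pi_fintype, Finset.sum_const, Finset.card_univ, smul_eq_mul] at hF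
    have hr := Submodule.finrank_mono hPF
    have hV₁ : finrank k V₁ ≤ Fintype.card ι * finrank k (LinearMap.range P) := by
      refine finrank_le_card_mul_of_iSup_range_eq_top
        (f := fun i => LinearMap.proj i ∘ₗ (LinearMap.range P).subtype) ?_
      rw [eq_top_iff, ← hg]
      refine iSup_mono fun i => ?_
      rintro _ ⟨x, rfl⟩
      exact ⟨⟨P x, x, rfl⟩, rfl⟩
    nlinarith
  · rintro ⟨h₁, h₂⟩
    set n := Fintype.card ι with hn
    have hn0 : 0 < n := Fintype.card_pos
    have h₂' : n * (finrank k V₂) + finrank k V₁ ≤ n * (n * finrank k V₁) := by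
      rwa [← mul_assoc, ← sq]
    have hle : finrank k V₂ ≤ n * finrank k V₁ :=
      Nat.le_of_mul_le_mul_left (le_of_add_le_left h₂') hn0
    obtain ⟨r, hr₀, hr₁, hr₂⟩ : ∃ r, r ≤ finrank k V₀ ∧ finrank k V₁ ≤ n * r ∧
        finrank k V₂ + r ≤ n * finrank k V₁ := by
      obtain ⟨s, hs⟩ := Nat.exists_eq_add_of_le hle
      refine ⟨min (finrank k V₀) s, min_le_left _ _, ?_, ?_⟩
      · rw [← Nat.mul_min_mul_left]
        rw [hs, mul_add] at h₂'
        exact le_min h₁ (by omega)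
      · rw [hs]
        exact Nat.add_le_add_left (min_le_right _ _) _
    obtain ⟨p, hp⟩ := exists_surjective_linearMap_of_finrank_le (k := k) (M := V₀)
      (N := Fin r → k) (by simpa using hr₀)
    obtain ⟨h, hh⟩ := exists_surjective_linearMap_of_finrank_le (k := k) (M := ι → Fin r → k)
      (N := V₁) (by simpa [finrank_pi_fintype, ← hn] using hr₁)
    let Q : (Fin r → k) →ₗ[k] (ι → V₁) :=
      LinearMap.pi fun i => h ∘ₗ LinearMap.single k (fun _ : ι => Fin r → k) i
    obtain ⟨q, hq⟩ := exists_surjective_linearMap_of_finrank_le (k := k)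
      (M := (ι → V₁) ⧸ LinearMap.range Q) (N := V₂) (by
        have h3 := (LinearMap.range Q).finrank_quotient_add_finrank
        have h4 := LinearMap.finrank_range_le Q
        rw [finrank_pi_fintype, Finset.sum_const, Finset.card_univ, smul_eq_mul, ← hn] at h3
        rw [finrank_fin_fun] at h4
        omega)
    let F := q ∘ₗ (LinearMap.range Q).mkQ
    refine ⟨fun i => F ∘ₗ LinearMap.single k (fun _ : ι => V₁) i,
      fun i => (h ∘ₗ LinearMap.single k (fun _ : ι => Fin r → k) i) ∘ₗ p, ?_, ?_, ?_⟩
    · ext x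
      have hsum : ∑ i, Pi.single i (Q (p x) i) = Q (p x) := Finset.univ_sum_single _
      have hF : F (Q (p x)) = 0 := by
        have : (LinearMap.range Q).mkQ (Q (p x)) = 0 := by simp
        simp only [F, LinearMap.comp_apply, this, map_zero]
      rw [← hsum, map_sum] at hF
      simpa [LinearMap.sum_apply, Q] using hF
    · simp_rw [LinearMap.range_comp_of_range_eq_top _ (LinearMap.range_eq_top.2 hp)]
      exact iSup_range_comp_single_eq_top hh
    · exact iSup_range_comp_single_eq_top (hq.comp (Submodule.mkQ_surjective _))

theorem iSup_range_sum_smul_le {ι k M N : Type*} [Fintype ι] [Field k]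
    [AddCommGroup M] [Module k M] [AddCommGroup N] [Module k N]
    (b : Matrix ι ι k) (g : ι → M →ₗ[k] N) :
    ⨆ i, LinearMap.range (∑ j, b i j • g j) ≤ ⨆ i, LinearMap.range (g i) := by
  refine iSup_le fun i => ?_
  rintro _ ⟨x, rfl⟩
  rw [LinearMap.sum_apply]
  exact Submodule.sum_mem _ fun j _ => Submodule.smul_mem _ _
    (Submodule.mem_iSup_of_mem j ⟨x, rfl⟩)

theorem sum_smul_sum_smul_of_mul_eq_one {ι k M : Type*} [Fintype ι] [DecidableEq ι] [Field k]
    [AddCommGroup M] [Module k M] {b c : Matrix ι ι k} (h : b * c = 1) (g : ι → M) (i : ι) :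
    ∑ j, b i j • ∑ l, c j l • g l = g i := by
  simp_rw [Finset.smul_sum, smul_smul]
  rw [Finset.sum_comm]
  simp_rw [← Finset.sum_smul, ← Matrix.mul_apply, h, Matrix.one_apply, ite_smul]
  simp

theorem iSup_range_sum_smul_eq {ι k M N : Type*} [Fintype ι] [DecidableEq ι] [Field k]
    [AddCommGroup M] [Module k M] [AddCommGroup N] [Module k N]
    {b c : Matrix ι ι k} (h : b * c = 1) (g : ι → M →ₗ[k] N) :
    ⨆ i, LinearMap.range (∑ j, c i j • g j) = ⨆ i, LinearMap.range (g i) := by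
  refine (iSup_range_sum_smul_le c g).antisymm ?_
  have := iSup_range_sum_smul_le b fun i => ∑ j, c i j • g j
  simpa only [sum_smul_sum_smul_of_mul_eq_one h] using this


/-- Theorem 4.1 of the paper: existence of a representation of
`𝒜 = k⟨x₁,…,xₙ⟩/((x₁,…,xₙ)³ + (S))`, `S = ∑ aᵢⱼ xᵢ xⱼ` with `det a ≠ 0`,
with radical layering `(d₀, d₁, d₂)` iff `d₁ ≤ n·d₀` and `n·d₂ ≤ (n²−1)·d₁`. -/
theorem stmt0 (k : Type*) [Field k] [IsAlgClosed k] (hk : ringChar k ≠ 2)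
    (n : ℕ) (hn : 1 ≤ n) (a : Matrix (Fin n) (Fin n) k) (ha : a.det ≠ 0)
    (d₀ d₁ d₂ : ℕ) :
    (∃ (A : Fin n → Matrix (Fin d₂) (Fin d₁) k)
       (C : Fin n → Matrix (Fin d₁) (Fin d₀) k),
        (∑ i, ∑ j, a i j • (A i * C j)) = 0 ∧
        (⨆ i, LinearMap.range (Matrix.mulVecLin (C i))) = ⊤ ∧
        (⨆ i, LinearMap.range (Matrix.mulVecLin (A i))) = ⊤) ↔
    (d₁ ≤ n * d₀ ∧ n * d₂ ≤ (n ^ 2 - 1) * d₁) := by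
  have : Nonempty (Fin n) := ⟨⟨0, hn⟩⟩
  have hu : IsUnit a.det := ha.isUnit
  have key := exists_jointly_surjective_sum_comp_eq_zero_iff (ι := Fin n) (k := k)
    (V₀ := Fin d₀ → k) (V₁ := Fin d₁ → k) (V₂ := Fin d₂ → k)
  simp only [finrank_fin_fun, Fintype.card_fin] at key
  have harith : n * d₂ ≤ (n ^ 2 - 1) * d₁ ↔ n * d₂ + d₁ ≤ n ^ 2 * d₁ := by
    have : d₁ ≤ n ^ 2 * d₁ := Nat.le_mul_of_pos_left _ (by positivity)
    rw [Nat.sub_mul, one_mul]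
    omega
  rw [harith, ← key]
  have hmul (A : Fin n → Matrix (Fin d₂) (Fin d₁) k) (C : Fin n → Matrix (Fin d₁) (Fin d₀) k) :
      ∑ i, ∑ j, a i j • (A i * C j) = ∑ i, A i * ∑ j, a i j • C j := by
    simp [Matrix.mul_sum]
  simp_rw [hmul]
  constructor
  · rintro ⟨A, C, h0, hC, hA⟩
    refine ⟨fun i => (A i).toLin', fun i => ∑ j, a i j • (C j).toLin', ?_, ?_, hA⟩
    · have := congrArg Matrix.toLin' h0
      simpa [Matrix.toLin'_mul] using this
    · rw [iSup_range_sum_smul_eq (a.nonsing_inv_mul hu)]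
      exact hC
  · rintro ⟨f, g, h0, hg, hf⟩
    refine ⟨fun i => (f i).toMatrix', fun i => (∑ j, a⁻¹ i j • g j).toMatrix', ?_, ?_, ?_⟩
    · have hg' (i : Fin n) : ∑ j, a i j • (∑ l, a⁻¹ j l • g l).toMatrix' = (g i).toMatrix' := by
        simpa only [map_sum, map_smul] using congrArg LinearMap.toMatrix'
          (sum_smul_sum_smul_of_mul_eq_one (a.mul_nonsing_inv hu) g i)
      simp_rw [hg', ← LinearMap.toMatrix'_comp]
      rw [← map_sum, h0, map_zero]
    · simp_rw [← Matrix.toLin'_apply', Matrix.toLin'_toMatrix']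
      rw [iSup_range_sum_smul_eq (a.mul_nonsing_inv hu), hg]
    · simpa only [← Matrix.toLin'_apply', Matrix.toLin'_toMatrix'] using hf
end

section
/- Let k be an algebraically closed field with char k ≠ 2 and n ≥ 2 a natural number. Let m be a natural number with 2 ≤ m ≤ n and let d₀ ≥ 1. Then there exist families A : Fin n → Matrix (Fin (m·n − 1)) (Fin m) k and C : Fin n → Matrix (Fin m) (Fin d₀) k such that ∑_i A i * C i = 0, ⨆_i LinearMap.range (Matrix.mulVecLin (C i)) = ⊤ in (Fin m → k), and ⨆_i LinearMap.range (Matrix.mulVecLin (A i)) = ⊤ in (Fin (m·n − 1) → k). -/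
/-- The ranges of a family of matrices span as soon as every vector is a sum of images. -/
theorem iSup_range_mulVecLin_eq_top {k ι p q : Type*} [CommSemiring k] [Fintype ι] [Fintype q]
    (M : ι → Matrix p q k) (h : ∀ v : p → k, ∃ x : ι → q → k, ∑ i, (M i).mulVec (x i) = v) :
    (⨆ i, LinearMap.range (Matrix.mulVecLin (M i))) = ⊤ := by
  refine eq_top_iff.2 fun v _ => ?_
  obtain ⟨x, rfl⟩ := h v
  exact Submodule.sum_mem _ fun i _ => Submodule.mem_iSup_of_mem i ⟨x i, rfl⟩

/-- A nonzero vector is killed by a surjection onto a space of dimension one less. -/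
theorem exists_surjective_apply_eq_zero {k V : Type*} [Field k] [AddCommGroup V] [Module k V]
    [FiniteDimensional k V] {t : V} (ht : t ≠ 0) {N : ℕ} (hN : Module.finrank k V - 1 = N) :
    ∃ f : V →ₗ[k] (Fin N → k), Function.Surjective f ∧ f t = 0 := by
  have hq : Module.finrank k (V ⧸ Submodule.span k {t}) = Module.finrank k (Fin N → k) := by
    have := Submodule.finrank_quotient_add_finrank (Submodule.span k {t})
    rw [finrank_span_singleton ht] at this
    rw [Module.finrank_fin_fun]
    omega
  let e := LinearEquiv.ofFinrankEq _ _ hq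
  refine ⟨e.toLinearMap ∘ₗ (Submodule.span k {t}).mkQ,
    e.surjective.comp (Submodule.mkQ_surjective _), ?_⟩
  simp [(Submodule.Quotient.mk_eq_zero _).2 (Submodule.mem_span_singleton_self t)]

/-- Lemma 4.7 of the paper: for `2 ≤ m ≤ n` and `d₀ ≥ 1` there exists a
representation of `𝒜 = k⟨x₁,…,xₙ⟩/((x₁,…,xₙ)³ + (∑ xᵢ²))` with radical
layering `(d₀, m, m·n − 1)`, i.e. a stratum datum of type `(d₀, m, m·n − 1)`. -/
theorem stmt6 (k : Type*) [Field k] [IsAlgClosed k] (hk : ringChar k ≠ 2)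
    (n : ℕ) (hn : 2 ≤ n) (m : ℕ) (hm2 : 2 ≤ m) (hmn : m ≤ n)
    (d₀ : ℕ) (hd₀ : 1 ≤ d₀) :
    ∃ (A : Fin n → Matrix (Fin (m * n - 1)) (Fin m) k)
      (C : Fin n → Matrix (Fin m) (Fin d₀) k),
      (∑ i, A i * C i) = 0 ∧
      (⨆ i, LinearMap.range (Matrix.mulVecLin (C i))) = ⊤ ∧
      (⨆ i, LinearMap.range (Matrix.mulVecLin (A i))) = ⊤ := by
  let t : Fin n × Fin m → k := fun p => if p.1 = Fin.castLE hmn p.2 then 1 else 0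
  have ht : t ≠ 0 := fun h => by
    have := congrFun h (Fin.castLE hmn ⟨0, by omega⟩, ⟨0, by omega⟩)
    simp [t] at this
  obtain ⟨f, hf, hft⟩ := exists_surjective_apply_eq_zero (k := k) ht (N := m * n - 1)
    (by simp [mul_comm])
  have hfx (x : Fin n × Fin m → k) (r) :
      ∑ i, ∑ j, f (Pi.single (i, j) 1) r * x (i, j) = f x r := by
    rw [LinearMap.pi_apply_eq_sum_univ f x, Finset.sum_apply, Fintype.sum_prod_type]
    refine Finset.sum_congr rfl fun i _ => Finset.sum_congr rfl fun j _ => ?_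
    rw [Pi.smul_apply, smul_eq_mul, mul_comm]
    have hsingle : (Pi.single (i, j) 1 : Fin n × Fin m → k) =
        fun p => if (i, j) = p then 1 else 0 := by
      ext p
      simp [Pi.single_apply, eq_comm]
    rw [hsingle]
  let c₀ : Fin d₀ := ⟨0, hd₀⟩
  refine ⟨fun i => Matrix.of fun r j => f (Pi.single (i, j) 1) r,
    fun i => Matrix.of fun j c => if c = c₀ then t (i, j) else 0, ?_, ?_, ?_⟩
  · ext r c
    simp only [Matrix.sum_apply, Matrix.mul_apply, Matrix.of_apply]
    by_cases hc : c = c₀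
    · simp only [hc, if_true, hfx, hft]
      rfl
    · simp [hc]
  · refine iSup_range_mulVecLin_eq_top _ fun v =>
      ⟨fun i _ => if h : i.val < m then v ⟨i, h⟩ else 0, ?_⟩
    ext j
    simp [Finset.sum_apply, Matrix.mulVec, dotProduct, t]
    rw [Finset.sum_eq_single (Fin.castLE hmn j) (fun i _ hi => by simp [hi]) (by simp)]
    simp
  · refine iSup_range_mulVecLin_eq_top _ fun v => ?_
    obtain ⟨x, rfl⟩ := hf v
    refine ⟨fun i j => x (i, j), ?_⟩
    ext r
    simpa [Finset.sum_apply, Matrix.mulVec, dotProduct] using hfx x r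
end

section
/- Let k be an algebraically closed field with char k ≠ 2 and n ≥ 1 a natural number. Let d₀, d₁, d₂ be natural numbers with d₁ ≤ n·d₀ and n·d₂ ≤ (n²−1)·d₁. Then the minimum, over all stratum data (A,C) of type (d₀,d₁,d₂), of Module.finrank k (⨅_i LinearMap.ker (Matrix.mulVecLin (C i))) equals (d₀ + d₂) − n·d₁ (truncated natural-number subtraction, i.e. max(d₀ + d₂ − n·d₁, 0) over the integers); that is, every stratum datum satisfies finrank(⨅_i ker C_i) ≥ (d₀ + d₂) − n·d₁, and some stratum datum attains this value. -/
/-- A stratum datum of type `(d₀, d₁, d₂)` over `k`: families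
`A : Fin n → Matrix (Fin d₂) (Fin d₁) k`, `C : Fin n → Matrix (Fin d₁) (Fin d₀) k`
with `∑ᵢ Aᵢ Cᵢ = 0`, the images of the `Cᵢ` spanning `k^{d₁}` and the images of
the `Aᵢ` spanning `k^{d₂}`. These correspond to representations of
`𝒜 = k⟨x₁,…,xₙ⟩/((x₁,…,xₙ)³ + (∑ xᵢ²))` with radical layering `(d₀,d₁,d₂)`. -/
def IsStratumDatum (k : Type*) [Field k] {n d₀ d₁ d₂ : ℕ}
    (A : Fin n → Matrix (Fin d₂) (Fin d₁) k)
    (C : Fin n → Matrix (Fin d₁) (Fin d₀) k) : Prop :=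
  (∑ i, A i * C i) = 0 ∧
  (⨆ i, LinearMap.range (Matrix.mulVecLin (C i))) = ⊤ ∧
  (⨆ i, LinearMap.range (Matrix.mulVecLin (A i))) = ⊤

open Module

section Helpers

variable {k V W : Type*} [Field k] [AddCommGroup V] [Module k V] [FiniteDimensional k V]
  [AddCommGroup W] [Module k W] [FiniteDimensional k W]

theorem Submodule.exists_le_finrank_eq (S : Submodule k V) {m : ℕ} (hS : finrank k S ≤ m)
    (hm : m ≤ finrank k V) : ∃ T : Submodule k V, S ≤ T ∧ finrank k T = m := by
  induction m, hS using Nat.le_induction with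
  | base => exact ⟨S, le_rfl, rfl⟩
  | succ m _ ih =>
    obtain ⟨T, hST, hT⟩ := ih (by omega)
    have hlt : T < ⊤ := Submodule.lt_top_of_finrank_lt_finrank (by omega)
    obtain ⟨v, -, hv⟩ := SetLike.exists_of_lt hlt
    exact ⟨T ⊔ Submodule.span k {v}, hST.trans le_sup_left, by
      rw [Submodule.finrank_sup_span_singleton hv, hT]⟩

theorem LinearMap.exists_range_eq (U : Submodule k V) (h : finrank k U ≤ finrank k W) :
    ∃ f : W →ₗ[k] V, LinearMap.range f = U := by
  obtain ⟨g, hg⟩ := finrank_le_iff_exists_linearMap.1 h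
  obtain ⟨r, hr⟩ := g.exists_leftInverse_of_injective (LinearMap.ker_eq_bot.2 hg)
  have hr' : LinearMap.range r = ⊤ :=
    LinearMap.range_eq_top.2 fun x ↦ ⟨g x, LinearMap.congr_fun hr x⟩
  exact ⟨U.subtype ∘ₗ r, by
    rw [LinearMap.range_comp, hr', Submodule.map_top, Submodule.range_subtype]⟩

theorem LinearMap.exists_surjective_ker_eq (K : Submodule k V)
    (h : finrank k K + finrank k W = finrank k V) :
    ∃ f : V →ₗ[k] W, Function.Surjective f ∧ LinearMap.ker f = K := by
  have e : (V ⧸ K) ≃ₗ[k] W := LinearEquiv.ofFinrankEq _ _ (by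
    have := K.finrank_quotient_add_finrank
    omega)
  exact ⟨e.toLinearMap ∘ₗ K.mkQ, e.surjective.comp K.mkQ_surjective, by
    rw [LinearEquiv.ker_comp, Submodule.ker_mkQ]⟩

theorem exists_submodule_finrank_eq_span_entries (k : Type*) [Field k] {n d e : ℕ}
    (hd : d ≤ n * e) (he : e ≤ n * d) :
    ∃ U : Submodule k (Fin n → Fin d → k), finrank k U = e ∧
      ⨆ i, U.map (LinearMap.proj i) = ⊤ := by
  obtain ⟨φ⟩ : Nonempty (Fin d ↪ Fin e × Fin n) :=
    Function.Embedding.nonempty_of_card_le (by simpa [mul_comm] using hd)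
  let u : Fin e → Fin n → Fin d → k := fun j i ↦
    Function.extend φ (fun a ↦ Pi.single a 1) 0 (j, i)
  obtain ⟨U, hU, hUe⟩ := (Submodule.span k (Set.range u)).exists_le_finrank_eq
    (m := e) ((finrank_range_le_card (R := k) u).trans_eq (Fintype.card_fin e)) (by simpa [finrank_pi_fintype] using he)
  refine ⟨U, hUe, ?_⟩
  rw [eq_top_iff, ← (Pi.basisFun k (Fin d)).span_eq, Submodule.span_le]
  rintro _ ⟨a, rfl⟩
  refine Submodule.mem_iSup_of_mem (φ a).2
    ⟨u (φ a).1, hU (Submodule.subset_span ⟨_, rfl⟩), ?_⟩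
  simp [u, φ.injective.extend_apply]

end Helpers

section Stacking

variable {k : Type*} [Field k] {n d₀ d₁ d₂ : ℕ}

theorem Matrix.iInf_ker_mulVecLin_eq_ker_pi (C : Fin n → Matrix (Fin d₁) (Fin d₀) k) :
    ⨅ i, LinearMap.ker (C i).mulVecLin = LinearMap.ker (LinearMap.pi fun i ↦ (C i).mulVecLin) :=
  (LinearMap.ker_pi _).symm

theorem Matrix.range_lsum_mulVecLin (A : Fin n → Matrix (Fin d₂) (Fin d₁) k) :
    LinearMap.range (LinearMap.lsum k (fun _ ↦ Fin d₁ → k) k fun i ↦ (A i).mulVecLin) =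
      ⨆ i, LinearMap.range (A i).mulVecLin := by
  rw [← Submodule.map_top, ← LinearMap.iSup_range_single, Submodule.map_iSup]
  congr! 2 with i
  rw [← LinearMap.range_comp]
  exact congrArg LinearMap.range (LinearMap.ext fun v ↦ LinearMap.lsum_piSingle ..)

theorem IsStratumDatum.le_finrank_iInf_ker {A : Fin n → Matrix (Fin d₂) (Fin d₁) k}
    {C : Fin n → Matrix (Fin d₁) (Fin d₀) k} (h : IsStratumDatum k A C) :
    d₀ + d₂ - n * d₁ ≤ finrank k ↥(⨅ i, LinearMap.ker (C i).mulVecLin) := by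
  obtain ⟨hAC, -, hA⟩ := h
  rw [Matrix.iInf_ker_mulVecLin_eq_ker_pi]
  rw [← Matrix.range_lsum_mulVecLin] at hA
  set f := LinearMap.pi fun i ↦ (C i).mulVecLin
  set g := LinearMap.lsum k (fun _ ↦ Fin d₁ → k) k fun i ↦ (A i).mulVecLin
  have hgf : LinearMap.range f ≤ LinearMap.ker g := by
    rintro _ ⟨v, rfl⟩
    have := congrArg (Matrix.mulVec · v) hAC
    simpa [f, g, LinearMap.lsum_apply, Matrix.sum_mulVec] using this
  have hf := f.finrank_range_add_finrank_ker
  have hg := g.finrank_range_add_finrank_ker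
  have hle := Submodule.finrank_mono hgf
  rw [hA, finrank_top] at hg
  simp only [finrank_pi_fintype, finrank_self, Fintype.card_fin, Finset.sum_const,
    Finset.card_univ, smul_eq_mul, mul_one] at hf hg
  omega

theorem exists_isStratumDatum_finrank_iInf_ker_eq {e : ℕ} (he : d₁ ≤ n * e) (he₀ : e ≤ d₀)
    (he₂ : e + d₂ ≤ n * d₁) :
    ∃ (A : Fin n → Matrix (Fin d₂) (Fin d₁) k) (C : Fin n → Matrix (Fin d₁) (Fin d₀) k),
      IsStratumDatum k A C ∧ finrank k ↥(⨅ i, LinearMap.ker (C i).mulVecLin) = d₀ - e := by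
  obtain ⟨U, hUe, hU⟩ := exists_submodule_finrank_eq_span_entries k he (by omega)
  obtain ⟨K, hUK, hK⟩ := U.exists_le_finrank_eq (m := n * d₁ - d₂) (by omega)
    (by simp [finrank_pi_fintype])
  obtain ⟨f, hf⟩ := LinearMap.exists_range_eq (W := Fin d₀ → k) U (by simpa [hUe] using he₀)
  obtain ⟨g, hg, hgK⟩ := LinearMap.exists_surjective_ker_eq (W := Fin d₂ → k) K (by
    simp only [hK, finrank_pi_fintype, finrank_self, Finset.sum_const, Finset.card_univ,
      Fintype.card_fin, smul_eq_mul, mul_one]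
    omega)
  let A : Fin n → Matrix (Fin d₂) (Fin d₁) k := fun i ↦
    LinearMap.toMatrix' (g ∘ₗ LinearMap.single k (fun _ ↦ Fin d₁ → k) i)
  let C : Fin n → Matrix (Fin d₁) (Fin d₀) k := fun i ↦
    LinearMap.toMatrix' (LinearMap.proj i ∘ₗ f)
  have hA (i) : (A i).mulVecLin = g ∘ₗ LinearMap.single k (fun _ ↦ Fin d₁ → k) i :=
    Matrix.toLin'_toMatrix' _
  have hC (i) : (C i).mulVecLin = LinearMap.proj i ∘ₗ f := Matrix.toLin'_toMatrix' _
  refine ⟨A, C, ⟨?_, ?_, ?_⟩, ?_⟩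
  · have hgf : ∑ i, (g ∘ₗ LinearMap.single k (fun _ ↦ Fin d₁ → k) i) ∘ₗ
        (LinearMap.proj i ∘ₗ f) = 0 := by
      refine LinearMap.ext fun v ↦ ?_
      have hv : f v ∈ LinearMap.ker g := hgK ▸ hUK (hf ▸ LinearMap.mem_range_self f v)
      simp only [LinearMap.sum_apply, LinearMap.comp_apply, LinearMap.zero_apply,
        ← map_sum, LinearMap.proj_apply, LinearMap.coe_single, Finset.univ_sum_single]
      exact hv
    simp only [A, C, ← LinearMap.toMatrix'_comp, ← map_sum, hgf, map_zero]
  · simp_rw [hC, LinearMap.range_comp, hf]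
    exact hU
  · simp_rw [hA, LinearMap.range_comp, ← Submodule.map_iSup]
    rw [LinearMap.iSup_range_single, Submodule.map_top, LinearMap.range_eq_top.2 hg]
  · have hker : ⨅ i, LinearMap.ker (C i).mulVecLin = LinearMap.ker f := by
      simp_rw [hC, ← LinearMap.ker_pi]
      rfl
    have := f.finrank_range_add_finrank_ker
    rw [hf, hUe, finrank_fintype_fun_eq_card, Fintype.card_fin] at this
    rw [hker]
    omega

end Stacking

/-- Proposition 5.4 of the paper: on the nonempty stratum of type
`(d₀, d₁, d₂)`, the minimum of `h₀(A,C) = dim ⨅ᵢ ker Cᵢ` equals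
`(d₀ + d₂) − n·d₁` (truncated subtraction). -/
theorem stmt10 (k : Type*) [Field k] [IsAlgClosed k] (hk : ringChar k ≠ 2)
    (n : ℕ) (hn : 1 ≤ n) (d₀ d₁ d₂ : ℕ)
    (h1 : d₁ ≤ n * d₀) (h2 : n * d₂ ≤ (n ^ 2 - 1) * d₁) :
    (∀ (A : Fin n → Matrix (Fin d₂) (Fin d₁) k)
       (C : Fin n → Matrix (Fin d₁) (Fin d₀) k), IsStratumDatum k A C →
        (d₀ + d₂) - n * d₁ ≤
          Module.finrank k ↥(⨅ i, LinearMap.ker (Matrix.mulVecLin (C i)))) ∧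
    (∃ (A : Fin n → Matrix (Fin d₂) (Fin d₁) k)
       (C : Fin n → Matrix (Fin d₁) (Fin d₀) k), IsStratumDatum k A C ∧
        Module.finrank k ↥(⨅ i, LinearMap.ker (Matrix.mulVecLin (C i))) =
          (d₀ + d₂) - n * d₁) := by
  refine ⟨fun A C h ↦ h.le_finrank_iInf_ker, ?_⟩
  have h3 : n * d₂ + d₁ ≤ n * (n * d₁) := by
    have : (n ^ 2 - 1) * d₁ + d₁ = n * (n * d₁) := by
      rw [← Nat.succ_mul, Nat.succ_eq_add_one, Nat.sub_add_cancel (Nat.one_le_pow _ _ hn)]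
      ring
    omega
  have h4 : d₂ ≤ n * d₁ := Nat.le_of_mul_le_mul_left (by omega) hn
  obtain ⟨A, C, hAC, hrank⟩ := exists_isStratumDatum_finrank_iInf_ker_eq (k := k)
    (n := n) (d₀ := d₀) (d₁ := d₁) (d₂ := d₂) (e := min d₀ (n * d₁ - d₂))
    (by
      rcases min_choice d₀ (n * d₁ - d₂) with h | h <;> rw [h]
      · exact h1
      · rw [Nat.mul_sub]
        omega)
    (min_le_left _ _) (by omega)
  exact ⟨A, C, hAC, by omega⟩
end

section
/- Let k be an algebraically closed field with char k ≠ 2 and n ≥ 1 a natural number. Let d₀, d₁, d₂ be natural numbers with d₁ ≤ n·d₀ and n·d₂ ≤ (n²−1)·d₁. Then the minimum, over all stratum data (A,C) of type (d₀,d₁,d₂), of Module.finrank k (⨅_i LinearMap.ker (Matrix.mulVecLin (A i))) equals d₁ − n·d₂ (truncated natural-number subtraction, i.e. max(d₁ − n·d₂, 0) over the integers); that is, every stratum datum satisfies finrank(⨅_i ker A_i) ≥ d₁ − n·d₂, and some stratum datum attains this value. -/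
/-- Every dimension between those of two nested subspaces is attained in between. -/
theorem Submodule.exists_between_finrank_eq {K V : Type*} [Field K] [AddCommGroup V] [Module K V]
    [FiniteDimensional K V] {S W : Submodule K V} (hSW : S ≤ W) {d : ℕ}
    (hS : Module.finrank K S ≤ d) (hW : d ≤ Module.finrank K W) :
    ∃ T : Submodule K V, S ≤ T ∧ T ≤ W ∧ Module.finrank K T = d := by
  induction d, hS using Nat.le_induction with
  | base => exact ⟨S, le_rfl, hSW, rfl⟩
  | succ d _ ih =>
    obtain ⟨T, hST, hTW, hT⟩ := ih (by omega)
    have hlt : T < W := lt_of_le_of_ne hTW (by rintro rfl; omega)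
    obtain ⟨w, hwW, hwT⟩ := SetLike.exists_of_lt hlt
    refine ⟨T ⊔ K ∙ w, hST.trans le_sup_left, sup_le hTW (by simpa using hwW), ?_⟩
    have hw : w ≠ 0 := by rintro rfl; exact hwT T.zero_mem
    have hdisj : T ⊓ K ∙ w = ⊥ :=
      disjoint_iff.mp ((Submodule.disjoint_span_singleton' hw).mpr hwT)
    have h := Submodule.finrank_sup_add_finrank_inf_eq T (K ∙ w)
    rw [hdisj, finrank_bot, finrank_span_singleton hw] at h
    omega

/-- The common kernel of `n` matrices of size `d₂ × d₁` has dimension at least `d₁ - n d₂`. -/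
theorem le_finrank_iInf_ker_mulVecLin {K : Type*} [Field K] {n d₁ d₂ : ℕ}
    (A : Fin n → Matrix (Fin d₂) (Fin d₁) K) :
    d₁ - n * d₂ ≤ Module.finrank K ↥(⨅ i, LinearMap.ker (Matrix.mulVecLin (A i))) := by
  rw [← LinearMap.ker_pi]
  have h := LinearMap.finrank_range_add_finrank_ker (LinearMap.pi fun i => (A i).mulVecLin)
  have h' := Submodule.finrank_le (LinearMap.range (LinearMap.pi fun i => (A i).mulVecLin))
  simp only [Module.finrank_pi_fintype, Module.finrank_self, Finset.sum_const, Finset.card_univ,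
    Fintype.card_fin, smul_eq_mul, mul_one] at h h'
  omega

/-- A subspace of `K^d` on which the first `m` coordinates vanish has dimension at most `d - m`. -/
theorem finrank_le_sub_of_coord_eq_zero {K : Type*} [Field K] {d m : ℕ}
    (U : Submodule K (Fin d → K)) (hU : ∀ v ∈ U, ∀ j : Fin d, j.val < m → v j = 0) :
    Module.finrank K U ≤ d - m := by
  let f : U →ₗ[K] (Fin (d - m) → K) :=
    (LinearMap.funLeft K K fun t : Fin (d - m) => (⟨m + t, by omega⟩ : Fin d)).domRestrict U
  have hf : Function.Injective f := by
    rw [injective_iff_map_eq_zero]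
    rintro ⟨v, hv⟩ h
    ext j
    rcases lt_or_ge j.val m with hj | hj
    · exact hU v hv j hj
    · have := congrFun h ⟨j - m, by omega⟩
      have hj' : (⟨m + (j.val - m), by omega⟩ : Fin d) = j := Fin.ext (by simp; omega)
      simpa [f, LinearMap.funLeft_apply, hj'] using this
  simpa using LinearMap.finrank_le_finrank_of_injective hf

/-- Stacking matrices whose rows form a linearly independent family gives a surjection. -/
theorem iSup_range_mulVecLin_eq_top_s11 {K : Type*} [Field K] {n d₁ d₂ : ℕ}
    {b : Fin d₂ → Fin n → Fin d₁ → K} (hb : LinearIndependent K b) :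
    ⨆ i, LinearMap.range (Matrix.mulVecLin (Matrix.of fun r j => b r i j)) = ⊤ := by
  by_contra hne
  obtain ⟨f, hf, hle⟩ := Submodule.exists_le_ker_of_lt_top _ (lt_top_iff_ne_top.mpr hne)
  obtain ⟨c, hf_apply⟩ : ∃ c : Fin d₂ → K, ∀ x, f x = ∑ r, x r * c r :=
    ⟨_, LinearMap.pi_apply_eq_sum_univ f⟩
  have hzero : ∑ r, c r • b r = 0 := by
    ext i j
    have hmem : (Matrix.of fun r j => b r i j).mulVecLin (Pi.single j 1) ∈ LinearMap.ker f :=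
      hle (Submodule.mem_iSup_of_mem i (LinearMap.mem_range_self _ _))
    rw [LinearMap.mem_ker, hf_apply] at hmem
    simpa [Finset.sum_apply, mul_comm] using hmem
  have hcoord := Fintype.linearIndependent_iff.mp hb _ hzero
  exact hf (LinearMap.ext fun x => by simp [hf_apply x, hcoord])

/-- The map sending `x ↦ (∑ᵢ x i (s n + i))ₛ`, with out-of-range entries read as zero. -/
def blockTrace (K : Type*) [Field K] (n d e : ℕ) : (Fin n → Fin d → K) →ₗ[K] (Fin e → K) where
  toFun x s := ∑ i : Fin n, ∑ j : Fin d, if s.val * n + i.val = j.val then x i j else 0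
  map_add' x y := by
    ext s
    simp only [Pi.add_apply, ← Finset.sum_add_distrib]
    refine Finset.sum_congr rfl fun i _ => Finset.sum_congr rfl fun j _ => ?_
    split_ifs <;> simp
  map_smul' c x := by
    ext s
    simp [Finset.mul_sum]

/-- The matrices whose `i`-th row is the coordinate vector at `r n + (i + 1) mod n`. -/
def shiftMatrix (K : Type*) [Field K] (n d r : ℕ) : Fin n → Fin d → K :=
  fun i j => if j.val = r * n + (i.val + 1) % n then 1 else 0

theorem blockTrace_shiftMatrix {K : Type*} [Field K] {n : ℕ} (hn : 2 ≤ n) (d e r : ℕ) :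
    blockTrace K n d e (shiftMatrix K n d r) = 0 := by
  ext s
  simp only [blockTrace, shiftMatrix, LinearMap.coe_mk, AddHom.coe_mk, Pi.zero_apply]
  refine Finset.sum_eq_zero fun i _ => Finset.sum_eq_zero fun j _ => ?_
  split_ifs with hs hr
  · exfalso
    have hmod : i.val % n = (i.val + 1) % n % n := by
      have := congrArg (· % n) (hs.trans hr)
      simpa [Nat.add_comm, Nat.add_mul_mod_self_right] using this
    have hi := i.isLt
    rw [Nat.mod_mod, Nat.mod_eq_of_lt hi] at hmod
    rcases Nat.lt_or_ge (i.val + 1) n with h | h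
    · rw [Nat.mod_eq_of_lt h] at hmod; omega
    · have : i.val + 1 = n := by omega
      rw [this, Nat.mod_self] at hmod; omega
  all_goals rfl

/-- A vector orthogonal to all rows of the first `d₂` shift matrices has its first `n d₂`
coordinates equal to zero. -/
theorem coord_eq_zero_of_shiftMatrix {K : Type*} [Field K] {n d₁ d₂ : ℕ} (v : Fin d₁ → K)
    (hv : ∀ (r : Fin d₂) (i : Fin n), ∑ j, shiftMatrix K n d₁ r i j * v j = 0)
    (j : Fin d₁) (hj : j.val < n * d₂) : v j = 0 := by
  have hn : 0 < n := Nat.pos_of_ne_zero (by rintro rfl; simp at hj)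
  have hmod := Nat.mod_lt j.val hn
  have hshift : ((j.val + (n - 1)) % n + 1) % n = j.val % n := by
    rw [Nat.mod_add_mod, show j.val + (n - 1) + 1 = j.val + n by omega, Nat.add_mod_right]
  have h := hv ⟨j.val / n, Nat.div_lt_of_lt_mul hj⟩ ⟨(j.val + (n - 1)) % n, Nat.mod_lt _ hn⟩
  have hdiv : j.val / n * n + j.val % n = j.val := by rw [mul_comm]; exact Nat.div_add_mod _ _
  simpa [shiftMatrix, hshift, hdiv, ← Fin.ext_iff] using h

/-- The matrices sending the `s`-th coordinate vector to the one at `s n + i`. -/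
def blockInclusion (K : Type*) [Field K] (n d₀ d₁ : ℕ) (i : Fin n) :
    Matrix (Fin d₁) (Fin d₀) K :=
  Matrix.of fun j s => if s.val * n + i.val = j.val then 1 else 0

theorem iSup_range_blockInclusion {K : Type*} [Field K] {n d₀ d₁ : ℕ} (h : d₁ ≤ n * d₀) :
    ⨆ i, LinearMap.range (Matrix.mulVecLin (blockInclusion K n d₀ d₁ i)) = ⊤ := by
  rw [eq_top_iff, ← (Pi.basisFun K (Fin d₁)).span_eq, Submodule.span_le]
  rintro _ ⟨j, rfl⟩
  have hj : j.val < n * d₀ := j.isLt.trans_le h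
  have hn : 0 < n := Nat.pos_of_ne_zero (by rintro rfl; simp at hj)
  refine Submodule.mem_iSup_of_mem ⟨j.val % n, Nat.mod_lt _ hn⟩
    ⟨Pi.single ⟨j.val / n, Nat.div_lt_of_lt_mul hj⟩ 1, ?_⟩
  have hdiv : j.val / n * n + j.val % n = j.val := by rw [mul_comm]; exact Nat.div_add_mod _ _
  ext l
  simp [blockInclusion, hdiv, Pi.single_apply, Fin.ext_iff, eq_comm]

theorem sum_mul_blockInclusion {K : Type*} [Field K] {n d₀ d₁ d₂ e : ℕ} (he : d₁ ≤ n * e)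
    {b : Fin d₂ → Fin n → Fin d₁ → K} (hb : ∀ r, blockTrace K n d₁ e (b r) = 0) :
    ∑ i, (Matrix.of fun r j => b r i j) * blockInclusion K n d₀ d₁ i = 0 := by
  ext r s
  simp only [Matrix.sum_apply, Matrix.mul_apply, Matrix.of_apply, blockInclusion, mul_ite, mul_one,
    mul_zero, Matrix.zero_apply]
  by_cases hs : s.val < e
  · exact congrFun (hb r) ⟨s, hs⟩
  · refine Finset.sum_eq_zero fun i _ => Finset.sum_eq_zero fun j _ => if_neg fun h => ?_
    have : n * e ≤ s.val * n := by rw [mul_comm]; exact Nat.mul_le_mul_right n (by omega)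
    have := j.isLt
    omega

theorem le_finrank_ker_blockTrace (K : Type*) [Field K] (n d e : ℕ) :
    n * d ≤ Module.finrank K (LinearMap.ker (blockTrace K n d e)) + e := by
  have h := LinearMap.finrank_range_add_finrank_ker (blockTrace K n d e)
  have h' := Submodule.finrank_le (LinearMap.range (blockTrace K n d e))
  simp only [Module.finrank_pi_fintype, Module.finrank_self, Finset.sum_const, Finset.card_univ,
    Fintype.card_fin, smul_eq_mul, mul_one] at h h'
  omega

theorem exists_isStratumDatum_finrank_le (K : Type*) [Field K] {n d₀ d₁ d₂ : ℕ} (hn : 1 ≤ n)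
    (h1 : d₁ ≤ n * d₀) (h2 : n * d₂ ≤ (n ^ 2 - 1) * d₁) :
    ∃ (A : Fin n → Matrix (Fin d₂) (Fin d₁) K) (C : Fin n → Matrix (Fin d₁) (Fin d₀) K),
      IsStratumDatum K A C ∧
        Module.finrank K ↥(⨅ i, LinearMap.ker (Matrix.mulVecLin (A i))) ≤ d₁ - n * d₂ := by
  have hcount : n * d₂ + d₁ ≤ n * (n * d₁) := by
    rw [Nat.sub_mul, one_mul, pow_two, mul_assoc] at h2
    have : d₁ ≤ n * (n * d₁) := by
      rw [← mul_assoc]; exact Nat.le_mul_of_pos_left _ (Nat.mul_pos hn hn)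
    omega
  have hd₂ : d₂ ≤ n * d₁ := Nat.le_of_mul_le_mul_left (by omega) hn
  have he : d₁ ≤ n * (n * d₁ - d₂) := by rw [Nat.mul_sub]; omega
  set e := n * d₁ - d₂ with he_def
  have hSW : Submodule.span K (Set.range fun r : Fin d₂ => shiftMatrix K n d₁ r) ≤
      LinearMap.ker (blockTrace K n d₁ e) := by
    rw [Submodule.span_le]
    rintro _ ⟨r, rfl⟩
    rcases Nat.lt_or_ge n 2 with hn' | hn'
    · obtain rfl : n = 1 := by omega
      have := r.isLt
      simp at h2
      omega
    · exact blockTrace_shiftMatrix hn' _ _ _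
  have hker := le_finrank_ker_blockTrace K n d₁ e
  obtain ⟨T, hST, hTW, hT⟩ := Submodule.exists_between_finrank_eq hSW (d := d₂)
    (by simpa [Set.finrank] using (finrank_range_le_card (R := K)
      fun r : Fin d₂ => shiftMatrix K n d₁ r)) (by omega)
  let b := Module.finBasisOfFinrankEq K T hT
  have hb : LinearIndependent K fun r => (b r : Fin n → Fin d₁ → K) :=
    b.linearIndependent.map' T.subtype T.ker_subtype
  refine ⟨fun i => Matrix.of fun r j => (b r : Fin n → Fin d₁ → K) i j, blockInclusion K n d₀ d₁,
    ⟨sum_mul_blockInclusion he fun r => hTW (b r).2, iSup_range_blockInclusion h1,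
      iSup_range_mulVecLin_eq_top_s11 hb⟩, ?_⟩
  refine finrank_le_sub_of_coord_eq_zero _ fun v hv => coord_eq_zero_of_shiftMatrix v fun r i => ?_
  let f : (Fin n → Fin d₁ → K) →ₗ[K] K :=
    (Fintype.linearCombination K v : (Fin d₁ → K) →ₗ[K] K) ∘ₗ LinearMap.proj i
  have hf : f ∘ₗ T.subtype = 0 := b.ext fun r => by
    have := congrFun ((Submodule.mem_iInf _).mp hv i) r
    simpa [f, Fintype.linearCombination_apply, Matrix.mulVec, dotProduct] using this
  have hr := LinearMap.congr_fun hf ⟨_, hST (Submodule.subset_span ⟨r, rfl⟩)⟩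
  simpa [f, Fintype.linearCombination_apply] using hr

/-- Lemma 5.8 of the paper: on the nonempty stratum of type `(d₀, d₁, d₂)`,
the minimum of `h₁(A,C) = dim ⨅ᵢ ker Aᵢ` equals `d₁ − n·d₂`
(truncated subtraction). -/
theorem stmt11 (k : Type*) [Field k] [IsAlgClosed k] (hk : ringChar k ≠ 2)
    (n : ℕ) (hn : 1 ≤ n) (d₀ d₁ d₂ : ℕ)
    (h1 : d₁ ≤ n * d₀) (h2 : n * d₂ ≤ (n ^ 2 - 1) * d₁) :
    (∀ (A : Fin n → Matrix (Fin d₂) (Fin d₁) k)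
       (C : Fin n → Matrix (Fin d₁) (Fin d₀) k), IsStratumDatum k A C →
        d₁ - n * d₂ ≤
          Module.finrank k ↥(⨅ i, LinearMap.ker (Matrix.mulVecLin (A i)))) ∧
    (∃ (A : Fin n → Matrix (Fin d₂) (Fin d₁) k)
       (C : Fin n → Matrix (Fin d₁) (Fin d₀) k), IsStratumDatum k A C ∧
        Module.finrank k ↥(⨅ i, LinearMap.ker (Matrix.mulVecLin (A i))) =
          d₁ - n * d₂) := by
  refine ⟨fun A _ _ => le_finrank_iInf_ker_mulVecLin A, ?_⟩
  obtain ⟨A, C, hAC, hle⟩ := exists_isStratumDatum_finrank_le k hn h1 h2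
  exact ⟨A, C, hAC, hle.antisymm (le_finrank_iInf_ker_mulVecLin A)⟩
end
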